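/- arXiv:1601.03008 — 2 statements merged into one kernel-verified Lean document; each statement's English description precedes it below -/
import Mathlib

section
/- Let V be a Ḡ-graded left R-module. (i) If the loop module L_π(V) is G-graded simple, then V is Ḡ-graded simple. (ii) If V is Ḡ-graded simple, then L_π(V) is G-graded simple if and only if the G-pregrading on V associated to its Ḡ-grading is thin. -/
/-! Common definitions: gradings on algebras and modules, graded simplicity,
homogeneous endomorphisms, graded subfields, and loop modules. -/

noncomputable section

namespace GradedPaper

variable {F : Type*} [Field F]

/-- `ℳ` is a direct sum decomposition of the `F`-vector space `V`:
every vector is a finite sum of homogeneous components, and such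
decompositions are unique (independence). -/
def IsVSDecomp {V ι : Type*} [AddCommGroup V] [Module F V]
    (ℳ : ι → Submodule F V) : Prop :=
  (∀ v : V, ∃ (t : Finset ι) (c : ι → V), (∀ i ∈ t, c i ∈ ℳ i) ∧ v = ∑ i ∈ t, c i) ∧
  (∀ (t : Finset ι) (c : ι → V), (∀ i ∈ t, c i ∈ ℳ i) → ∑ i ∈ t, c i = 0 →
    ∀ i ∈ t, c i = 0)

/-- A `G`-grading on a unital associative `F`-algebra `R`:
`R = ⊕_{g ∈ G} R_g` with `1 ∈ R_0` and `R_g · R_h ⊆ R_{g+h}`.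
(The abelian grading group is written additively.) -/
structure AlgebraGrading (F : Type*) [Field F] (G : Type*) [AddCommGroup G]
    (R : Type*) [Ring R] [Algebra F R] where
  comp : G → Submodule F R
  decomp : IsVSDecomp comp
  one_mem : (1 : R) ∈ comp 0
  mul_mem : ∀ {g h : G} {r s : R}, r ∈ comp g → s ∈ comp h → r * s ∈ comp (g + h)

variable {G : Type*} [AddCommGroup G] {R : Type*} [Ring R] [Algebra F R]

/-- A grading of a left `R`-module `V` by the group `κ`, compatible with the
`G`-grading `𝒜` of `R` along the homomorphism `p : G →+ κ`
(so `R_g · V_k ⊆ V_{p g + k}`).  For `p = id` this is a `G`-graded module;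
for `p : G →+ G ⧸ H` the natural projection, this is a `G/H`-graded module
(for the induced `G/H`-grading of `R`). -/
structure ModuleGrading (𝒜 : AlgebraGrading F G R) {κ : Type*} [AddCommGroup κ]
    (p : G →+ κ) (V : Type*) [AddCommGroup V] [Module F V] [Module R V]
    [IsScalarTower F R V] where
  comp : κ → Submodule F V
  decomp : IsVSDecomp comp
  smul_mem : ∀ {g : G} {k : κ} {r : R} {v : V},
    r ∈ 𝒜.comp g → v ∈ comp k → r • v ∈ comp (p g + k)

/-- `W` is a graded submodule: every element of `W` is a finite sum of
homogeneous elements of `W`. -/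
def IsGradedSubmodule {κ V : Type*} [AddCommGroup V] [Module F V] [Module R V]
    (ℳ : κ → Submodule F V) (W : Submodule R V) : Prop :=
  ∀ w ∈ W, ∃ (t : Finset κ) (c : κ → V),
    (∀ i ∈ t, c i ∈ ℳ i ∧ c i ∈ W) ∧ w = ∑ i ∈ t, c i

/-- The graded module with components `ℳ` is graded simple. -/
def IsGradedSimpleModule (R : Type*) [Ring R] {κ V : Type*} [AddCommGroup V]
    [Module F V] [Module R V] (ℳ : κ → Submodule F V) : Prop :=
  (∃ v : V, v ≠ 0) ∧ ∀ W : Submodule R V, IsGradedSubmodule ℳ W → W = ⊥ ∨ W = ⊤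

/-- An `R`-module endomorphism of `V` is homogeneous of degree `d`. -/
def IsHomogeneousEnd {κ V : Type*} [Add κ] [AddCommGroup V] [Module F V]
    [Module R V] (ℳ : κ → Submodule F V) (d : κ) (f : Module.End R V) : Prop :=
  ∀ ⦃k : κ⦄ ⦃v : V⦄, v ∈ ℳ k → f v ∈ ℳ (k + d)

/-- The degree-`d` homogeneous component of the (graded) centralizer
`C(V) = End_R(V)`. -/
def homogComp {κ V : Type*} [Add κ] [AddCommGroup V] [Module F V] [Module R V]
    [SMulCommClass R F V] (ℳ : κ → Submodule F V) (d : κ) :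
    Submodule F (Module.End R V) where
  carrier := {f | IsHomogeneousEnd ℳ d f}
  add_mem' := fun hf hg k v hv => (ℳ _).add_mem (hf hv) (hg hv)
  zero_mem' := fun k v hv => (ℳ _).zero_mem
  smul_mem' := fun c f hf k v hv => by
    simpa using (ℳ _).smul_mem c (hf hv)

/-- `f` belongs to the graded centralizer: it is a finite sum of homogeneous
`R`-module endomorphisms. -/
def IsInGradedCentralizer {κ V : Type*} [Add κ] [AddCommGroup V] [Module F V]
    [Module R V] (ℳ : κ → Submodule F V) (f : Module.End R V) : Prop :=
  ∃ (t : Finset κ) (c : κ → Module.End R V),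
    (∀ d ∈ t, IsHomogeneousEnd ℳ d (c d)) ∧ f = ∑ d ∈ t, c d

/-- The module `V` is central (Schurian): its centralizer consists of the
scalar multiples of the identity. -/
def IsCentralModule (F : Type*) [Field F] (R V : Type*) [Ring R] [AddCommGroup V]
    [Module F V] [Module R V] : Prop :=
  ∀ f : Module.End R V, ∃ a : F, ∀ v : V, f v = a • v

/-- A graded subfield of a graded algebra with homogeneous components `𝒟`:
a graded unital subalgebra (given by its homogeneous components `comp`)
which is commutative and in which every nonzero homogeneous element is
invertible. -/
structure GradedSubfield {κ : Type*} [AddCommGroup κ] {A : Type*} [Ring A]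
    [Module F A] (𝒟 : κ → Submodule F A) where
  comp : κ → Submodule F A
  le : ∀ k, comp k ≤ 𝒟 k
  one_mem : (1 : A) ∈ comp 0
  mul_mem : ∀ {g h : κ} {a b : A}, a ∈ comp g → b ∈ comp h → a * b ∈ comp (g + h)
  comm : ∀ {g h : κ} {a b : A}, a ∈ comp g → b ∈ comp h → a * b = b * a
  inv_mem : ∀ {g : κ} {a : A}, a ∈ comp g → a ≠ 0 →
    ∃ b ∈ comp (-g), a * b = 1 ∧ b * a = 1

/-- The support of a graded subfield. -/
def GradedSubfield.support {κ : Type*} [AddCommGroup κ] {A : Type*} [Ring A]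
    [Module F A] {𝒟 : κ → Submodule F A} (𝒦 : GradedSubfield 𝒟) : Set κ :=
  {k | 𝒦.comp k ≠ ⊥}

/-- A graded subfield is maximal if the only graded subfield containing it
is itself. -/
def GradedSubfield.IsMaximal {κ : Type*} [AddCommGroup κ] {A : Type*} [Ring A]
    [Module F A] {𝒟 : κ → Submodule F A} (𝒦 : GradedSubfield 𝒟) : Prop :=
  ∀ 𝒦' : GradedSubfield 𝒟, (∀ k, 𝒦.comp k ≤ 𝒦'.comp k) → ∀ k, 𝒦'.comp k = 𝒦.comp k

/-- A graded subfield is isomorphic, as a graded algebra, to the group algebra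
of its support: it has a homogeneous basis `c` (one-dimensional components)
which is multiplicative. -/
def GradedSubfield.IsGroupAlgebraOfSupport {κ : Type*} [AddCommGroup κ]
    {A : Type*} [Ring A] [Module F A] {𝒟 : κ → Submodule F A}
    (𝒦 : GradedSubfield 𝒟) : Prop :=
  ∃ c : κ → A, c 0 = 1 ∧
    (∀ k ∈ 𝒦.support, c k ∈ 𝒦.comp k ∧ c k ≠ 0 ∧ 𝒦.comp k = Submodule.span F {c k}) ∧
    (∀ k₁ ∈ 𝒦.support, ∀ k₂ ∈ 𝒦.support, c (k₁ + k₂) = c k₁ * c k₂)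

section Loop

variable {Q₁ Q₂ : Type*}

/-- The underlying space of the loop module: inside `V ⊗ F[Q₁] ≅ (Q₁ →₀ V)`,
the subspace `⊕_{a ∈ Q₁} V_{s a} ⊗ a` of finitely supported functions `f` with
`f a ∈ V_{s a}`. -/
def LoopSubmodule {V : Type*} [AddCommGroup V] [Module F V] (s : Q₁ → Q₂)
    (ℳ : Q₂ → Submodule F V) : Submodule F (Q₁ →₀ V) where
  carrier := {f | ∀ a : Q₁, f a ∈ ℳ (s a)}
  add_mem' := fun hf hg a => by simpa using (ℳ _).add_mem (hf a) (hg a)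
  zero_mem' := fun a => by simpa using (ℳ _).zero_mem
  smul_mem' := fun c f hf a => by simpa using (ℳ _).smul_mem c (hf a)

/-- The degree-`a` homogeneous component of the loop module. -/
def loopComp {V : Type*} [AddCommGroup V] [Module F V] (s : Q₁ → Q₂)
    (ℳ : Q₂ → Submodule F V) (a : Q₁) : Submodule F ↥(LoopSubmodule s ℳ) where
  carrier := {x | ∀ b : Q₁, b ≠ a → (x : Q₁ →₀ V) b = 0}
  add_mem' := by
    intro x y hx hy b hb
    simp [hx b hb, hy b hb]
  zero_mem' := by intro b hb; simp
  smul_mem' := by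
    intro c x hx b hb
    simp [hx b hb]

/-- The scalar multiplication of a (possibly non-canonical) module structure,
written explicitly. -/
def msmul {S M : Type*} [Semiring S] [AddCommMonoid M] (i : Module S M)
    (r : S) (x : M) : M :=
  @SMul.smul S M i.toDistribMulAction.toMulAction.toSMul r x

/-- `i` is the loop-module `R`-action: a homogeneous element `r ∈ R_g` acts on
`v ⊗ a` by `r • (v ⊗ a) = (r v) ⊗ (p g + a)`; in terms of values of finitely
supported functions, `(r • x) a = r • x (a - p g)`. -/
def IsLoopSMul [AddCommGroup Q₁] (𝒜 : AlgebraGrading F G R) (p : G →+ Q₁)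
    (s : Q₁ → Q₂) {V : Type*} [AddCommGroup V] [Module F V] [Module R V]
    (ℳ : Q₂ → Submodule F V) (i : Module R ↥(LoopSubmodule s ℳ)) : Prop :=
  ∀ {g : G} {r : R}, r ∈ 𝒜.comp g → ∀ (x : ↥(LoopSubmodule s ℳ)) (a : Q₁),
    ((msmul i r x : ↥(LoopSubmodule s ℳ)) : Q₁ →₀ V) a = r • ((x : Q₁ →₀ V) (a - p g))

/-- The right-shift operator `1 ⊗ d` on the loop module:
`v ⊗ a ↦ v ⊗ (a + d)`. -/
def rshiftFun [AddCommGroup Q₁] {V : Type*} [AddCommGroup V] [Module F V]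
    (s : Q₁ → Q₂) (ℳ : Q₂ → Submodule F V) (d : Q₁) (hd : ∀ a, s (a + d) = s a) :
    ↥(LoopSubmodule s ℳ) → ↥(LoopSubmodule s ℳ) :=
  fun x => ⟨Finsupp.equivMapDomain (Equiv.addRight d) (x : Q₁ →₀ V), by
    intro a
    have key : Finsupp.equivMapDomain (Equiv.addRight d) (x : Q₁ →₀ V) a
        = (x : Q₁ →₀ V) (a - d) := by
      rw [Finsupp.equivMapDomain_apply]
      congr 1
      simp [sub_eq_add_neg]
    rw [key]
    have h1 : s (a - d) = s a := by
      have h2 := hd (a - d)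
      rw [show a - d + d = a by abel] at h2
      exact h2.symm
    exact h1 ▸ x.2 (a - d)⟩

end Loop

section Twist

variable (H : AddSubgroup G)

/-- `i` is the `R`-module structure on (the finitely-supported-functions model
`{f : G/H →₀ V | f q ∈ V_q}` of) the `G/H`-graded module `V`, twisted by the
scalar factors `cf`: a homogeneous `r ∈ R_g` acts on `v ∈ V_k` by
`r • v = cf g k • (r v) ∈ V_{ḡ + k}`. -/
def IsTwistedSMul (𝒜 : AlgebraGrading F G R) {V : Type*} [AddCommGroup V]
    [Module F V] [Module R V] (ℳ : G ⧸ H → Submodule F V) (cf : G → G ⧸ H → F)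
    (i : Module R ↥(LoopSubmodule (id : G ⧸ H → G ⧸ H) ℳ)) : Prop :=
  ∀ {g : G} {r : R}, r ∈ 𝒜.comp g → ∀ (x : ↥(LoopSubmodule (id : G ⧸ H → G ⧸ H) ℳ))
    (q : G ⧸ H),
    ((msmul i r x : ↥(LoopSubmodule (id : G ⧸ H → G ⧸ H) ℳ)) : (G ⧸ H) →₀ V) q
      = cf g (q - QuotientAddGroup.mk g) •
          (r • ((x : (G ⧸ H) →₀ V) (q - QuotientAddGroup.mk g)))

end Twist

section Pregrading

/-- A `G`-pregrading of the left `R`-module `V`: a family of subspaces with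
`V = Σ_g V_g` and `R_g · V_h ⊆ V_{g+h}`. -/
def IsPregrading (𝒜 : AlgebraGrading F G R) {V : Type*} [AddCommGroup V]
    [Module F V] [Module R V] (P : G → Submodule F V) : Prop :=
  (⨆ g, P g) = (⊤ : Submodule F V) ∧
  ∀ {g k : G} {r : R} {v : V}, r ∈ 𝒜.comp g → v ∈ P k → r • v ∈ P (g + k)

/-- A pregrading is thin if it admits no proper refinement. -/
def IsThinPregrading (𝒜 : AlgebraGrading F G R) {V : Type*} [AddCommGroup V]
    [Module F V] [Module R V] (P : G → Submodule F V) : Prop :=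
  IsPregrading 𝒜 P ∧
  ∀ P' : G → Submodule F V, IsPregrading 𝒜 P' → (∀ g, P' g ≤ P g) → P' = P

end Pregrading

section Extras

open TensorProduct

variable {G : Type*} [AddCommGroup G] {R : Type*} [Ring R] [Algebra F R]

lemma mk'_add_right_mem (H : AddSubgroup G) (h : ↥H) (a : G) :
    (QuotientAddGroup.mk' H) (a + (h : G)) = (QuotientAddGroup.mk' H) a := by
  simpa using QuotientAddGroup.mk_add_of_mem a h.2

/-- The right-shift operator `1 ⊗ h`, `h ∈ H`, on the loop module `L_π(V)`
(for `π : G → G/H` the natural projection): `v ⊗ g ↦ v ⊗ (g + h)`. -/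
def loopShift (H : AddSubgroup G) {V : Type*} [AddCommGroup V] [Module F V]
    (ℳ : G ⧸ H → Submodule F V) (h : ↥H) :
    ↥(LoopSubmodule (⇑(QuotientAddGroup.mk' H)) ℳ) →
      ↥(LoopSubmodule (⇑(QuotientAddGroup.mk' H)) ℳ) :=
  rshiftFun (⇑(QuotientAddGroup.mk' H)) ℳ (h : G) (mk'_add_right_mem H h)

lemma twist_elt_mem (H : AddSubgroup G) (ξ : G ⧸ H → G)
    (hξ : ∀ q, (QuotientAddGroup.mk' H) (ξ q) = q) (g : G) (k : G ⧸ H) :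
    g + ξ k - ξ ((QuotientAddGroup.mk' H) g + k) ∈ H := by
  have h0 : (QuotientAddGroup.mk' H) (g + ξ k - ξ ((QuotientAddGroup.mk' H) g + k)) = 0 := by
    rw [map_sub, map_add, hξ, hξ]
    abel
  exact (QuotientAddGroup.eq_zero_iff _).mp h0

/-- The scalar factors `χ(g + ξ(k̄) - ξ(ḡ + k̄))` defining the module `V`
twisted by a character `χ` of `H`, relative to the section `ξ` of the natural
projection `π : G → G/H`. -/
def twistFactor (H : AddSubgroup G) (ξ : G ⧸ H → G)
    (hξ : ∀ q, (QuotientAddGroup.mk' H) (ξ q) = q) (χ : AddChar ↥H Fˣ) :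
    G → G ⧸ H → F :=
  fun g k =>
    ((χ ⟨g + ξ k - ξ ((QuotientAddGroup.mk' H) g + k), twist_elt_mem H ξ hξ g k⟩ : Fˣ) : F)

/-- The `G/H`-grading induced on a quotient `W/N` of a `G`-graded module `W`:
the component of degree `ḡ` is the image of `⊕_{h ∈ H} W_{g+h}`. -/
def quotGradeComp {W : Type*} [AddCommGroup W] [Module F W] [Module R W]
    [IsScalarTower F R W] (H : AddSubgroup G) (ℳ : G → Submodule F W)
    (N : Submodule R W) : G ⧸ H → Submodule F (W ⧸ N) :=
  fun q => ⨆ g : {g : G // (QuotientAddGroup.mk' H) g = q},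
    (ℳ (g : G)).map ((N.mkQ).restrictScalars F)

/-- The submodule `W · ker ρ` of `W`, where `ρ` is the homomorphism of unital
algebras `𝓕 → F` determined by `ρ(c_h) = ρ h` on the multiplicative
homogeneous basis `c` of the graded subfield `𝓕 ≅ FH` of the centralizer:
`W · ker ρ = Σ_{h ∈ H} W·(c_h - ρ(h)·1)`. -/
def kerSubmodule {W : Type*} [AddCommGroup W] [Module F W] [Module R W]
    [SMulCommClass R F W] {H : AddSubgroup G} (c : ↥H → Module.End R W)
    (ρ : ↥H → F) : Submodule R W :=
  ⨆ h : ↥H, LinearMap.range (c h - ρ h • (1 : Module.End R W))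

/-- The grading of the coordinate space `ι' → F` with coordinates of degrees
`gdeg`. -/
def coordComp {ι' : Type*} (gdeg : ι' → G) (g : G) : Submodule F (ι' → F) where
  carrier := {x | ∀ i, gdeg i ≠ g → x i = 0}
  add_mem' := fun hx hy i hi => by
    simp only [Pi.add_apply, hx i hi, hy i hi, add_zero]
  zero_mem' := fun i hi => rfl
  smul_mem' := fun a x hx i hi => by
    simp only [Pi.smul_apply, hx i hi, smul_zero]

/-- The natural grading of a tensor product of two graded algebras (or graded
vector spaces): the component of degree `g` is spanned by the products
`a ⊗ b` of homogeneous elements with `deg a + deg b = g`. -/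
def tensorGradeComp {A B : Type*} [AddCommGroup A] [Module F A] [AddCommGroup B]
    [Module F B] (Ac : G → Submodule F A) (Bc : G → Submodule F B) (g : G) :
    Submodule F (A ⊗[F] B) :=
  Submodule.span F {x | ∃ (g₁ g₂ : G) (a : A) (b : B),
    g₁ + g₂ = g ∧ a ∈ Ac g₁ ∧ b ∈ Bc g₂ ∧ x = a ⊗ₜ[F] b}

/-- The action of `r ∈ R` on an `R`-module `V`, viewed as an `F`-linear
endomorphism of `V`; i.e. the representation `R → End_F(V)`. -/
def actionEnd (F : Type*) [Field F] {R V : Type*} [Ring R] [AddCommGroup V]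
    [Module F V] [Module R V] [SMulCommClass R F V] (r : R) : Module.End F V where
  toFun v := r • v
  map_add' := smul_add r
  map_smul' a v := by simpa using smul_comm r a v

end Extras

end GradedPaper

namespace GradedPaper

universe u_K

section Helpers

variable {F : Type*} [Field F] {G : Type*} [AddCommGroup G]
    {R : Type*} [Ring R] [Algebra F R] {H : AddSubgroup G}
    {V : Type*} [AddCommGroup V] [Module F V] [Module R V] [IsScalarTower F R V]
    {𝒜 : AlgebraGrading F G R}
    {𝒱 : ModuleGrading 𝒜 (QuotientAddGroup.mk' H) V}

/-- Homogeneous element `v ⊗ a` of the loop module. -/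
def loopSingle (ℳ : G ⧸ H → Submodule F V) (a : G) (v : V)
    (hv : v ∈ ℳ (QuotientAddGroup.mk' H a)) :
    ↥(LoopSubmodule (⇑(QuotientAddGroup.mk' H)) ℳ) :=
  ⟨Finsupp.single a v, by
    classical
    intro b
    by_cases h : a = b
    · subst h; simpa using hv
    · rw [Finsupp.single_eq_of_ne (Ne.symm h)]; exact (ℳ _).zero_mem⟩

lemma loop_eq_sum (ℳ : G ⧸ H → Submodule F V)
    (x : ↥(LoopSubmodule (⇑(QuotientAddGroup.mk' H)) ℳ)) :
    x = ∑ a ∈ (x : G →₀ V).support, loopSingle ℳ a ((x : G →₀ V) a) (x.2 a) := by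
  apply Subtype.ext
  rw [AddSubmonoidClass.coe_finsetSum]
  exact ((x : G →₀ V).sum_single).symm

lemma loopSingle_mem (ℳ : G ⧸ H → Submodule F V) (a : G) (v : V)
    (hv : v ∈ ℳ (QuotientAddGroup.mk' H a)) :
    loopSingle ℳ a v hv ∈ loopComp (⇑(QuotientAddGroup.mk' H)) ℳ a := by
  intro b hb
  exact Finsupp.single_eq_of_ne hb

/-- The submodule of the loop module attached to a compatible family of subspaces. -/
def famSub (iL : Module R ↥(LoopSubmodule (⇑(QuotientAddGroup.mk' H)) 𝒱.comp))
    (hloop : IsLoopSMul 𝒜 (AddMonoidHom.id G) (⇑(QuotientAddGroup.mk' H)) 𝒱.comp iL)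
    (P : G → Submodule F V)
    (hP : ∀ {g k : G} {r : R} {v : V}, r ∈ 𝒜.comp g → v ∈ P k → r • v ∈ P (g + k)) :
    Submodule R ↥(LoopSubmodule (⇑(QuotientAddGroup.mk' H)) 𝒱.comp) where
  carrier := {x | ∀ a, (x : G →₀ V) a ∈ P a}
  add_mem' := fun hx hy a => (P a).add_mem (hx a) (hy a)
  zero_mem' := fun a => by simp
  smul_mem' := by
    intro r x hx a
    obtain ⟨t, c, hc, rfl⟩ := 𝒜.decomp.1 r
    rw [Finset.sum_smul, AddSubmonoidClass.coe_finsetSum, Finsupp.finsetSum_apply]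
    refine (P a).sum_mem fun i hi => ?_
    have h1 : ((c i • x : ↥(LoopSubmodule (⇑(QuotientAddGroup.mk' H)) 𝒱.comp)) : G →₀ V) a
      = c i • (x : G →₀ V) (a - i) := hloop (hc i hi) x a
    rw [h1]
    have := hP (hc i hi) (hx (a - i))
    rwa [add_sub_cancel] at this

lemma famSub_graded (iL : Module R ↥(LoopSubmodule (⇑(QuotientAddGroup.mk' H)) 𝒱.comp))
    (hloop : IsLoopSMul 𝒜 (AddMonoidHom.id G) (⇑(QuotientAddGroup.mk' H)) 𝒱.comp iL)
    (P : G → Submodule F V)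
    (hP : ∀ {g k : G} {r : R} {v : V}, r ∈ 𝒜.comp g → v ∈ P k → r • v ∈ P (g + k)) :
    IsGradedSubmodule (loopComp (⇑(QuotientAddGroup.mk' H)) 𝒱.comp)
      (famSub iL hloop P hP) := by
  classical
  intro x hx
  refine ⟨(x : G →₀ V).support, fun a => loopSingle 𝒱.comp a ((x : G →₀ V) a) (x.2 a), ?_,
    loop_eq_sum _ x⟩
  intro a _
  refine ⟨loopSingle_mem _ _ _ _, fun b => ?_⟩
  change Finsupp.single a _ b ∈ P b
  by_cases h : a = b
  · subst h; simpa using hx a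
  · rw [Finsupp.single_eq_of_ne (Ne.symm h)]; exact (P b).zero_mem

/-- If the loop module is graded simple, a compatible family contained in the grading
either vanishes on homogeneous elements or is everything. -/
lemma fam_dichotomy (iL : Module R ↥(LoopSubmodule (⇑(QuotientAddGroup.mk' H)) 𝒱.comp))
    (hloop : IsLoopSMul 𝒜 (AddMonoidHom.id G) (⇑(QuotientAddGroup.mk' H)) 𝒱.comp iL)
    (hs : IsGradedSimpleModule R (loopComp (⇑(QuotientAddGroup.mk' H)) 𝒱.comp))
    (P : G → Submodule F V)
    (hP : ∀ {g k : G} {r : R} {v : V}, r ∈ 𝒜.comp g → v ∈ P k → r • v ∈ P (g + k)) :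
    (∀ a, ∀ v ∈ 𝒱.comp (QuotientAddGroup.mk' H a), v ∈ P a → v = 0) ∨
    (∀ a, ∀ v ∈ 𝒱.comp (QuotientAddGroup.mk' H a), v ∈ P a) := by
  classical
  rcases hs.2 _ (famSub_graded iL hloop P hP) with h | h
  · left
    intro a v hv hvP
    have hm : loopSingle 𝒱.comp a v hv ∈ famSub iL hloop P hP := by
      intro b
      change Finsupp.single a _ b ∈ P b
      by_cases h : a = b
      · subst h; simpa using hvP
      · rw [Finsupp.single_eq_of_ne (Ne.symm h)]; exact (P b).zero_mem
    rw [h, Submodule.mem_bot] at hm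
    have h2 : Finsupp.single a v = 0 := congrArg Subtype.val hm
    simpa using h2
  · right
    intro a v hv
    have hm : loopSingle 𝒱.comp a v hv ∈ famSub iL hloop P hP := by rw [h]; trivial
    have h2 : Finsupp.single a v a ∈ P a := hm a
    simpa using h2

/-- Closure under homogeneous scalars gives closure under all scalars. -/
lemma iSup_smul_mem (P : G → Submodule F V)
    (hP : ∀ {g k : G} {r : R} {v : V}, r ∈ 𝒜.comp g → v ∈ P k → r • v ∈ P (g + k))
    (r : R) (v : V) (hv : v ∈ ⨆ g, P g) : r • v ∈ ⨆ g, P g := by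
  obtain ⟨t, c, hc, rfl⟩ := 𝒜.decomp.1 r
  rw [Finset.sum_smul]
  refine Submodule.sum_mem _ fun i hi => ?_
  induction hv using Submodule.iSup_induction' with
  | mem k w hw => exact Submodule.mem_iSup_of_mem (i + k) (hP (hc i hi) hw)
  | zero => simp
  | add x y _ _ hx hy => rw [smul_add]; exact Submodule.add_mem _ hx hy

lemma part_one (iL : Module R ↥(LoopSubmodule (⇑(QuotientAddGroup.mk' H)) 𝒱.comp))
    (hloop : IsLoopSMul 𝒜 (AddMonoidHom.id G) (⇑(QuotientAddGroup.mk' H)) 𝒱.comp iL)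
    (hs : IsGradedSimpleModule R (loopComp (⇑(QuotientAddGroup.mk' H)) 𝒱.comp)) :
    IsGradedSimpleModule R 𝒱.comp := by
  refine ⟨?_, fun W hW => ?_⟩
  · obtain ⟨x, hx⟩ := hs.1
    by_contra! hcon
    exact hx (Subtype.ext (Finsupp.ext fun a => hcon _))
  · rcases fam_dichotomy iL hloop hs (fun _ => W.restrictScalars F)
      (fun {g k r v} _ hv => W.smul_mem r hv) with h | h
    · left
      rw [eq_bot_iff]
      intro w hw
      obtain ⟨t, c, hc, rfl⟩ := hW w hw
      rw [Submodule.mem_bot]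
      refine Finset.sum_eq_zero fun i hi => ?_
      obtain ⟨a, rfl⟩ := QuotientAddGroup.mk'_surjective H i
      exact h a _ (hc _ hi).1 (hc _ hi).2
    · right
      rw [eq_top_iff]
      intro w _
      obtain ⟨t, c, hc, rfl⟩ := 𝒱.decomp.1 w
      refine W.sum_mem fun i hi => ?_
      obtain ⟨a, rfl⟩ := QuotientAddGroup.mk'_surjective H i
      exact h a _ (hc _ hi)

lemma assoc_pregrading :
    IsPregrading 𝒜 (fun g : G => 𝒱.comp ((QuotientAddGroup.mk' H) g)) := by
  refine ⟨?_, ?_⟩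
  · rw [eq_top_iff]
    intro w _
    obtain ⟨t, c, hc, rfl⟩ := 𝒱.decomp.1 w
    refine Submodule.sum_mem _ fun i hi => ?_
    obtain ⟨a, rfl⟩ := QuotientAddGroup.mk'_surjective H i
    exact Submodule.mem_iSup_of_mem a (hc _ hi)
  · intro g k r v hr hv
    have := 𝒱.smul_mem hr hv
    rw [← map_add] at this
    exact this

lemma part_two_mp (iL : Module R ↥(LoopSubmodule (⇑(QuotientAddGroup.mk' H)) 𝒱.comp))
    (hloop : IsLoopSMul 𝒜 (AddMonoidHom.id G) (⇑(QuotientAddGroup.mk' H)) 𝒱.comp iL)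
    (hs : IsGradedSimpleModule R (loopComp (⇑(QuotientAddGroup.mk' H)) 𝒱.comp)) :
    IsThinPregrading 𝒜 (fun g : G => 𝒱.comp ((QuotientAddGroup.mk' H) g)) := by
  refine ⟨assoc_pregrading, fun P' hP' hle => ?_⟩
  rcases fam_dichotomy iL hloop hs P' hP'.2 with h | h
  · exfalso
    obtain ⟨v, hv⟩ := (part_one iL hloop hs).1
    have hb : ∀ g, P' g = ⊥ := fun g => by
      rw [eq_bot_iff]
      intro w hw
      exact h g w (hle g hw) hw
    have h1 := hP'.1
    simp only [hb, iSup_bot] at h1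
    have : v ∈ (⊥ : Submodule F V) := by rw [h1]; trivial
    exact hv (by simpa using this)
  · funext g
    exact le_antisymm (hle g) (fun v hv => h g v hv)

lemma loop_algebraMap_smul
    (iL : Module R ↥(LoopSubmodule (⇑(QuotientAddGroup.mk' H)) 𝒱.comp))
    (hloop : IsLoopSMul 𝒜 (AddMonoidHom.id G) (⇑(QuotientAddGroup.mk' H)) 𝒱.comp iL)
    (c : F) (x : ↥(LoopSubmodule (⇑(QuotientAddGroup.mk' H)) 𝒱.comp)) (a : G) :
    (((c • (1 : R)) • x : ↥(LoopSubmodule (⇑(QuotientAddGroup.mk' H)) 𝒱.comp)) : G →₀ V) a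
      = c • (x : G →₀ V) a := by
  have h : (((c • (1 : R)) • x : ↥(LoopSubmodule (⇑(QuotientAddGroup.mk' H)) 𝒱.comp)) :
      G →₀ V) a = (c • (1 : R)) • (x : G →₀ V) (a - 0) :=
    hloop ((𝒜.comp 0).smul_mem c 𝒜.one_mem) x a
  rw [h, sub_zero, smul_assoc, one_smul]

/-- The family of subspaces of `V` attached to a submodule of the loop module. -/
def subFam (iL : Module R ↥(LoopSubmodule (⇑(QuotientAddGroup.mk' H)) 𝒱.comp))
    (hloop : IsLoopSMul 𝒜 (AddMonoidHom.id G) (⇑(QuotientAddGroup.mk' H)) 𝒱.comp iL)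
    (W : Submodule R ↥(LoopSubmodule (⇑(QuotientAddGroup.mk' H)) 𝒱.comp)) (g : G) :
    Submodule F V where
  carrier := {v | ∃ x ∈ W, x ∈ loopComp (⇑(QuotientAddGroup.mk' H)) 𝒱.comp g ∧
    (x : G →₀ V) g = v}
  add_mem' := by
    rintro _ _ ⟨x, hx, hxg, rfl⟩ ⟨y, hy, hyg, rfl⟩
    exact ⟨x + y, W.add_mem hx hy, Submodule.add_mem _ hxg hyg, rfl⟩
  zero_mem' := ⟨0, W.zero_mem, Submodule.zero_mem _, rfl⟩
  smul_mem' := by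
    rintro c _ ⟨x, hx, hxg, rfl⟩
    refine ⟨(c • (1 : R)) • x, W.smul_mem _ hx, ?_, loop_algebraMap_smul iL hloop c x g⟩
    intro b hb
    rw [loop_algebraMap_smul iL hloop, hxg b hb, smul_zero]

lemma subFam_smul (iL : Module R ↥(LoopSubmodule (⇑(QuotientAddGroup.mk' H)) 𝒱.comp))
    (hloop : IsLoopSMul 𝒜 (AddMonoidHom.id G) (⇑(QuotientAddGroup.mk' H)) 𝒱.comp iL)
    (W : Submodule R ↥(LoopSubmodule (⇑(QuotientAddGroup.mk' H)) 𝒱.comp))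
    {g k : G} {r : R} {v : V} (hr : r ∈ 𝒜.comp g) (hv : v ∈ subFam iL hloop W k) :
    r • v ∈ subFam iL hloop W (g + k) := by
  obtain ⟨x, hx, hxg, rfl⟩ := hv
  have h : ∀ a, ((r • x : ↥(LoopSubmodule (⇑(QuotientAddGroup.mk' H)) 𝒱.comp)) : G →₀ V) a
      = r • (x : G →₀ V) (a - g) := fun a => hloop hr x a
  refine ⟨r • x, W.smul_mem r hx, ?_, ?_⟩
  · intro b hb
    rw [h, hxg (b - g) (fun hh => hb (by rw [← hh]; abel)), smul_zero]
  · rw [h, add_sub_cancel_left]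

lemma subFam_le (iL : Module R ↥(LoopSubmodule (⇑(QuotientAddGroup.mk' H)) 𝒱.comp))
    (hloop : IsLoopSMul 𝒜 (AddMonoidHom.id G) (⇑(QuotientAddGroup.mk' H)) 𝒱.comp iL)
    (W : Submodule R ↥(LoopSubmodule (⇑(QuotientAddGroup.mk' H)) 𝒱.comp)) (g : G) :
    subFam iL hloop W g ≤ 𝒱.comp (QuotientAddGroup.mk' H g) := by
  rintro _ ⟨x, _, _, rfl⟩
  exact x.2 g

lemma part_two_mpr (iL : Module R ↥(LoopSubmodule (⇑(QuotientAddGroup.mk' H)) 𝒱.comp))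
    (hloop : IsLoopSMul 𝒜 (AddMonoidHom.id G) (⇑(QuotientAddGroup.mk' H)) 𝒱.comp iL)
    (hV : IsGradedSimpleModule R 𝒱.comp)
    (hthin : IsThinPregrading 𝒜 (fun g : G => 𝒱.comp ((QuotientAddGroup.mk' H) g))) :
    IsGradedSimpleModule R (loopComp (⇑(QuotientAddGroup.mk' H)) 𝒱.comp) := by
  classical
  refine ⟨?_, fun W hW => ?_⟩
  · obtain ⟨v, hv⟩ := hV.1
    obtain ⟨t, c, hc, rfl⟩ := 𝒱.decomp.1 v
    obtain ⟨i, hi, hne⟩ := Finset.exists_ne_zero_of_sum_ne_zero hv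
    obtain ⟨a, rfl⟩ := QuotientAddGroup.mk'_surjective H i
    refine ⟨loopSingle 𝒱.comp a _ (hc _ hi), fun h0 => hne ?_⟩
    have h2 : Finsupp.single a (c (QuotientAddGroup.mk' H a)) = 0 := congrArg Subtype.val h0
    simpa using h2
  · -- the graded submodule of `V` generated by the family
    let S : Submodule R V :=
      { carrier := ((⨆ g, subFam iL hloop W g : Submodule F V) : Set V)
        add_mem' := fun hx hy => Submodule.add_mem _ hx hy
        zero_mem' := Submodule.zero_mem _
        smul_mem' := fun r v hv =>
          iSup_smul_mem (𝒜 := 𝒜) _ (fun hr hv => subFam_smul iL hloop W hr hv) r v hv }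
    have hS : ∀ v, v ∈ S ↔ v ∈ ⨆ g, subFam iL hloop W g := fun v => Iff.rfl
    have hSg : IsGradedSubmodule 𝒱.comp S := by
      intro w hw
      obtain ⟨f, hf⟩ : ∃ f : G →₀ V, (∀ i, f i ∈ subFam iL hloop W i) ∧ (f.sum fun _ x => x) = w :=
        (Submodule.mem_iSup_iff_exists_finsupp _ _).1 hw
      refine ⟨f.support.image (QuotientAddGroup.mk' H),
        fun q => ∑ a ∈ f.support.filter (fun a => QuotientAddGroup.mk' H a = q), f a, ?_, ?_⟩
      · intro q _
        refine ⟨Submodule.sum_mem _ fun a ha => ?_, Submodule.sum_mem _ fun a _ => ?_⟩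
        · rw [← (Finset.mem_filter.1 ha).2]
          exact subFam_le iL hloop W a (hf.1 a)
        · exact (hS _).2 (Submodule.mem_iSup_of_mem a (hf.1 a))
      · rw [← hf.2, Finsupp.sum]
        exact (Finset.sum_fiberwise_of_maps_to
          (fun a ha => Finset.mem_image_of_mem _ ha) _).symm
    rcases hV.2 S hSg with h | h
    · left
      rw [eq_bot_iff]
      intro x hx
      obtain ⟨t, c, hc, rfl⟩ := hW x hx
      rw [Submodule.mem_bot]
      refine Finset.sum_eq_zero fun i hi => ?_
      apply Subtype.ext
      apply Finsupp.ext
      intro b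
      by_cases hb : b = i
      · subst hb
        have : ((c b : G →₀ V) b) ∈ S :=
          (hS _).2 (Submodule.mem_iSup_of_mem b ⟨c b, (hc b hi).2, (hc b hi).1, rfl⟩)
        rw [h, Submodule.mem_bot] at this
        exact this
      · exact (hc i hi).1 b hb
    · right
      have hpre : IsPregrading 𝒜 (subFam iL hloop W) := by
        refine ⟨?_, fun hr hv => subFam_smul iL hloop W hr hv⟩
        rw [eq_top_iff]
        intro v _
        rw [← hS, h]; trivial
      have heq := hthin.2 _ hpre (subFam_le iL hloop W)
      rw [eq_top_iff]
      intro x _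
      rw [loop_eq_sum _ x]
      refine W.sum_mem fun a _ => ?_
      have hm : (x : G →₀ V) a ∈ subFam iL hloop W a := by
        rw [congrFun heq a]; exact x.2 a
      obtain ⟨y, hy, hyg, hya⟩ := hm
      have : loopSingle 𝒱.comp a ((x : G →₀ V) a) (x.2 a) = y := by
        apply Subtype.ext
        apply Finsupp.ext
        intro b
        change Finsupp.single a _ b = _
        by_cases hb : b = a
        · subst hb; rw [hya]; simp
        · rw [Finsupp.single_eq_of_ne hb, hyg b hb]
      rw [this]
      exact hy

end Helpers

/-- Let `V` be a `G/H`-graded left `R`-module.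
(i) If the loop module `L_π(V)` is `G`-graded simple, then `V` is `G/H`-graded
simple.  (ii) If `V` is `G/H`-graded simple, then `L_π(V)` is `G`-graded
simple if and only if the `G`-pregrading on `V` associated to its
`G/H`-grading is thin. -/
theorem statement7 {F : Type*} [Field F] {G : Type*} [AddCommGroup G]
    {R : Type*} [Ring R] [Algebra F R] (H : AddSubgroup G)
    {V : Type*} [AddCommGroup V] [Module F V] [Module R V] [IsScalarTower F R V]
    (𝒜 : AlgebraGrading F G R)
    (𝒱 : ModuleGrading 𝒜 (QuotientAddGroup.mk' H) V)
    (iL : Module R ↥(LoopSubmodule (⇑(QuotientAddGroup.mk' H)) 𝒱.comp))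
    (hloop : IsLoopSMul 𝒜 (AddMonoidHom.id G) (⇑(QuotientAddGroup.mk' H)) 𝒱.comp iL) :
    (IsGradedSimpleModule R (loopComp (⇑(QuotientAddGroup.mk' H)) 𝒱.comp) →
      IsGradedSimpleModule R 𝒱.comp) ∧
    (IsGradedSimpleModule R 𝒱.comp →
      (IsGradedSimpleModule R (loopComp (⇑(QuotientAddGroup.mk' H)) 𝒱.comp) ↔
        IsThinPregrading 𝒜 (fun g : G => 𝒱.comp ((QuotientAddGroup.mk' H) g)))) := by
  exact ⟨part_one iL hloop, fun hV =>
    ⟨part_two_mp iL hloop, part_two_mpr iL hloop hV⟩⟩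

end GradedPaper
end
end

section
/- Let ξ: Ḡ → G be a section of π and let V be a Ḡ-graded left R-module. Let χ: G → F^× be a character of G and denote its restriction to H also by χ. Then the twisted module V^χ (twist by the character χ|_H, relative to ξ) is isomorphic, as a Ḡ-graded left R-module, to V^{α_χ} (the module V twisted by the automorphism α_χ of R); an isomorphism is given by v_ḡ ↦ χ(ξ(ḡ))·v_ḡ for v_ḡ ∈ V_ḡ. -/
/-! Common definitions: gradings on algebras and modules, graded simplicity,
homogeneous endomorphisms, graded subfields, and loop modules. -/

noncomputable section

namespace GradedPaper

/-- Diagonal rescaling of a finitely supported section by units. -/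
def diagScale {F : Type*} [Field F] {Q V : Type*} [AddCommGroup V] [Module F V]
    (ℳ : Q → Submodule F V) (c : Q → Fˣ) :
    ↥(LoopSubmodule (id : Q → Q) ℳ) →ₗ[F] ↥(LoopSubmodule (id : Q → Q) ℳ) where
  toFun x := ⟨Finsupp.onFinset (x : Q →₀ V).support (fun q => (c q : F) • (x : Q →₀ V) q)
      (fun q hq => by
        rw [Finsupp.mem_support_iff]
        intro h
        exact hq (by rw [h, smul_zero])),
    fun q => (ℳ q).smul_mem _ (x.2 q)⟩
  map_add' x y := by
    ext q
    simp
  map_smul' a x := by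
    ext q
    simp [smul_comm a]

lemma diagScale_apply {F : Type*} [Field F] {Q V : Type*} [AddCommGroup V] [Module F V]
    (ℳ : Q → Submodule F V) (c : Q → Fˣ) (x : ↥(LoopSubmodule (id : Q → Q) ℳ)) (q : Q) :
    (diagScale ℳ c x : Q →₀ V) q = (c q : F) • (x : Q →₀ V) q := rfl

lemma msmul_sum_left {S M ι : Type*} [Semiring S] [AddCommMonoid M] (i : Module S M)
    (t : Finset ι) (c : ι → S) (x : M) :
    msmul i (∑ j ∈ t, c j) x = ∑ j ∈ t, msmul i (c j) x :=
  letI := i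
  Finset.sum_smul

/-- For a section `ξ` of `π : G → G/H`, a `G/H`-graded
module `V` and a character `χ` of `G`, the module `V^χ` (twist by `χ|_H`
relative to `ξ`) is isomorphic to `V^{α_χ}` (twist by the automorphism `α_χ`
of `R`), via `v_ḡ ↦ χ(ξ(ḡ)) • v_ḡ`. -/
theorem statement12 {F : Type*} [Field F] {G : Type*} [AddCommGroup G]
    {R : Type*} [Ring R] [Algebra F R] (H : AddSubgroup G)
    (ξ : G ⧸ H → G) (hξ : ∀ q, (QuotientAddGroup.mk' H) (ξ q) = q)
    {V : Type*} [AddCommGroup V] [Module F V] [Module R V] [IsScalarTower F R V]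
    (𝒜 : AlgebraGrading F G R)
    (𝒱 : ModuleGrading 𝒜 (QuotientAddGroup.mk' H) V)
    (χ : AddChar G Fˣ)
    (i₁ : Module R ↥(LoopSubmodule (id : G ⧸ H → G ⧸ H) 𝒱.comp))
    (h₁ : IsTwistedSMul H 𝒜 𝒱.comp
      (fun g k => ((χ (g + ξ k - ξ ((QuotientAddGroup.mk' H) g + k)) : Fˣ) : F)) i₁)
    (i₂ : Module R ↥(LoopSubmodule (id : G ⧸ H → G ⧸ H) 𝒱.comp))
    (h₂ : IsTwistedSMul H 𝒜 𝒱.comp (fun g _ => ((χ g : Fˣ) : F)) i₂) :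
    ∃ e : ↥(LoopSubmodule (id : G ⧸ H → G ⧸ H) 𝒱.comp) ≃ₗ[F]
        ↥(LoopSubmodule (id : G ⧸ H → G ⧸ H) 𝒱.comp),
      (∀ (r : R) (x : ↥(LoopSubmodule (id : G ⧸ H → G ⧸ H) 𝒱.comp)),
        e (msmul i₁ r x) = msmul i₂ r (e x)) ∧
      (∀ (x : ↥(LoopSubmodule (id : G ⧸ H → G ⧸ H) 𝒱.comp)) (q : G ⧸ H),
        (↑(e x) : (G ⧸ H) →₀ V) q = ((χ (ξ q) : Fˣ) : F) • (↑x : (G ⧸ H) →₀ V) q) := by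
  refine ⟨LinearEquiv.ofLinearMap (diagScale 𝒱.comp fun q => χ (ξ q))
    (diagScale 𝒱.comp fun q => (χ (ξ q))⁻¹) ?_ ?_, ?_, ?_⟩
  · ext x q
    simp [diagScale_apply, smul_smul]
  · ext x q
    simp [diagScale_apply, smul_smul]
  · intro r x
    change diagScale 𝒱.comp (fun q => χ (ξ q)) (msmul i₁ r x)
      = msmul i₂ r (diagScale 𝒱.comp (fun q => χ (ξ q)) x)
    obtain ⟨t, c, hc, rfl⟩ := 𝒜.decomp.1 r
    rw [msmul_sum_left, msmul_sum_left, map_sum]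
    refine Finset.sum_congr rfl fun g hg => ?_
    ext q
    have e1 := h₁ (hc g hg) x q
    have e2 := h₂ (hc g hg) (diagScale 𝒱.comp (fun q => χ (ξ q)) x) q
    rw [diagScale_apply, e1, e2, diagScale_apply, smul_algebra_smul_comm _ (c g), smul_smul, smul_smul]
    congr 1
    rw [← Units.val_mul, ← Units.val_mul, ← AddChar.map_add_eq_mul, ← AddChar.map_add_eq_mul]
    congr 2
    have hq : (QuotientAddGroup.mk' H) g + (q - QuotientAddGroup.mk g) = q := by
      rw [QuotientAddGroup.mk'_apply]
      abel
    rw [hq]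
    abel
  · intro x q
    rfl

end GradedPaper
end
end
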